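/- Let a < b be real numbers and let f ∈ C²([a,b]) be a complex-valued function. Then the limit lim_{R→∞} Σ_{r=−R}^{R} ∫_a^b f(x)e(rx) dx exists and equals Σ*_{a≤n≤b} f(n). -/

import Mathlib

open Complex Filter

noncomputable section

/-- `ee x = exp (2 π i x)`. -/
def ee (x : ℝ) : ℂ := Complex.exp (2 * Real.pi * Complex.I * x)

/-- Starred sum `Σ*_{a ≤ n ≤ b} h n`: sum over integers `n` with `a ≤ n ≤ b`,
where a term whose index equals an endpoint is given weight `1/2`. -/
def starSum (a b : ℝ) (h : ℤ → ℂ) : ℂ :=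
  ∑ n ∈ Finset.Icc ⌈a⌉ ⌊b⌋, (if (n : ℝ) = a ∨ (n : ℝ) = b then (1/2 : ℂ) else 1) * h n

theorem continuous_ee_mul (r : ℝ) : Continuous fun x : ℝ => ee (r * x) := by
  unfold ee
  fun_prop

theorem ee_zero : ee 0 = 1 := by simp [ee]

theorem ee_add (x y : ℝ) : ee (x + y) = ee x * ee y := by
  unfold ee
  rw [← Complex.exp_add]
  push_cast
  ring_nf

theorem ee_int (n : ℤ) : ee n = 1 := by
  unfold ee
  rw [Complex.exp_eq_one_iff]
  exact ⟨n, by push_cast; ring⟩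

/-- The Dirichlet kernel of period one. -/
def dirichletKer (R : ℕ) (x : ℝ) : ℂ := ∑ r ∈ Finset.Icc (-(R : ℤ)) (R : ℤ), ee ((r : ℝ) * x)

theorem continuous_dirichletKer (R : ℕ) : Continuous (dirichletKer R) := by
  unfold dirichletKer
  exact continuous_finsetSum _ fun r _ => continuous_ee_mul r

theorem dirichletKer_mul (R : ℕ) (x : ℝ) :
    dirichletKer R x * (ee x - 1) = ee (((R : ℝ) + 1) * x) - ee (-(R : ℝ) * x) := by
  induction R with
  | zero => simp [dirichletKer, ee_zero]
  | succ R ih =>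
    have h : Finset.Icc (-((R + 1 : ℕ) : ℤ)) ((R + 1 : ℕ) : ℤ) =
        insert (-((R + 1 : ℕ) : ℤ)) (insert ((R + 1 : ℕ) : ℤ) (Finset.Icc (-(R : ℤ)) R)) := by
      ext k
      simp only [Finset.mem_Icc, Finset.mem_insert]
      omega
    have hs : dirichletKer (R + 1) x =
        ee (-((R : ℝ) + 1) * x) + (ee (((R : ℝ) + 1) * x) + dirichletKer R x) := by
      unfold dirichletKer
      rw [h, Finset.sum_insert, Finset.sum_insert]
      · push_cast
        rfl
      · simp
      · simp only [Finset.mem_Icc, Finset.mem_insert]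
        omega
    have e1 : ee (-(R : ℝ) * x) = ee (-((R : ℝ) + 1) * x) * ee x := by
      rw [← ee_add]; ring_nf
    have e2 : ee (((R : ℝ) + 1 + 1) * x) = ee (((R : ℝ) + 1) * x) * ee x := by
      rw [← ee_add]; ring_nf
    rw [hs, add_mul, add_mul, ih]
    push_cast
    rw [e1, e2]
    ring

theorem dirichletKer_reflect (R : ℕ) (m : ℤ) (x : ℝ) :
    dirichletKer R (2 * m - x) = dirichletKer R x := by
  unfold dirichletKer
  refine Finset.sum_nbij' (fun r => -r) (fun r => -r) ?_ ?_ ?_ ?_ ?_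
  · intro r; simp only [Finset.mem_Icc]; omega
  · intro r; simp only [Finset.mem_Icc]; omega
  · simp
  · simp
  · intro r _
    have : (r : ℝ) * (2 * m - x) = ((2 * r * m : ℤ) : ℝ) + ((-r : ℤ) : ℝ) * x := by
      push_cast; ring
    rw [this, ee_add, ee_int, one_mul]

theorem integral_ee_unit_interval (r : ℤ) (c : ℝ) :
    ∫ x in c..(c + 1), ee ((r : ℝ) * x) = if r = 0 then 1 else 0 := by
  split_ifs with h
  · simp [h, ee_zero]
  · have hc : (2 * Real.pi * Complex.I * r : ℂ) ≠ 0 := by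
      simp [h, Real.pi_ne_zero]
    have h1 : ∀ x : ℝ, ee ((r : ℝ) * x) = Complex.exp (2 * Real.pi * Complex.I * r * x) := by
      intro x; unfold ee; push_cast; ring_nf
    have h2 : ee ((r : ℝ) * (c + 1)) = ee ((r : ℝ) * c) := by
      rw [mul_add, ee_add, mul_one, ee_int, mul_one]
    simp_rw [h1]
    rw [integral_exp_mul_complex hc, ← h1, ← h1, h2, sub_self, zero_div]

theorem integral_dirichletKer_unit_interval (R : ℕ) (c : ℝ) :
    ∫ x in c..(c + 1), dirichletKer R x = 1 := by
  unfold dirichletKer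
  rw [intervalIntegral.integral_finsetSum
    fun (r : ℤ) _ => (continuous_ee_mul r).intervalIntegrable _ _]
  simp_rw [integral_ee_unit_interval]
  simp

theorem integral_dirichletKer_reflect (R : ℕ) (m : ℤ) (t : ℝ) :
    ∫ x in (2 * m - t)..m, dirichletKer R x = ∫ x in m..t, dirichletKer R x := by
  have h := intervalIntegral.integral_comp_sub_left (a := m) (b := t) (dirichletKer R) (2 * m : ℝ)
  simp_rw [dirichletKer_reflect] at h
  rw [h]
  congr 1
  ring

theorem integral_dirichletKer_half (R : ℕ) (m : ℤ) :
    ∫ x in (m : ℝ)..(m + 1 / 2), dirichletKer R x = 1 / 2 := by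
  have h1 := integral_dirichletKer_reflect R m (m + 1 / 2)
  have h2 := integral_dirichletKer_unit_interval R (2 * m - (m + 1 / 2))
  have h3 := intervalIntegral.integral_add_adjacent_intervals (μ := MeasureTheory.volume)
    ((continuous_dirichletKer R).intervalIntegrable (2 * m - (m + 1 / 2) : ℝ) m)
    ((continuous_dirichletKer R).intervalIntegrable (m : ℝ) (m + 1 / 2))
  rw [show (2 * m - (m + 1 / 2) + 1 : ℝ) = m + 1 / 2 by ring, ← h3, h1] at h2
  linear_combination h2 / 2

theorem tendsto_integral_mul_ee {a b : ℝ} (hab : a ≤ b) (g : ℝ → ℂ) :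
    Tendsto (fun w : ℝ => ∫ x in a..b, g x * ee (w * x)) (cocompact ℝ) (nhds 0) := by
  have h := (Real.tendsto_integral_exp_smul_cocompact ((Set.Ioc a b).indicator g)).comp
    (Homeomorph.neg ℝ).isClosedEmbedding.tendsto_cocompact
  refine h.congr fun w => ?_
  rw [intervalIntegral.integral_of_le hab, ← MeasureTheory.integral_indicator measurableSet_Ioc]
  refine MeasureTheory.integral_congr_ae (Eventually.of_forall fun x => ?_)
  by_cases hx : x ∈ Set.Ioc a b
  · simp only [Set.indicator_of_mem hx, Homeomorph.coe_neg, Circle.smul_def,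
      Real.fourierChar_apply, smul_eq_mul, ee]
    push_cast
    ring_nf
  · simp [Set.indicator_of_notMem hx]

theorem four_mul_abs_le_norm_ee_sub_one {m : ℤ} {x : ℝ} (hx : |x - m| ≤ 1 / 2) :
    4 * |x - m| ≤ ‖ee x - 1‖ := by
  have h1 : ee x = ee (x - m) := by
    have := ee_add (x - m) m
    rwa [sub_add_cancel, ee_int, mul_one] at this
  have h2 : ee (x - m) = Complex.exp (Complex.I * ((2 * Real.pi * (x - m) : ℝ) : ℂ)) := by
    unfold ee; push_cast; ring_nf
  rw [h1, h2, Complex.norm_exp_I_mul_ofReal_sub_one, norm_mul, Real.norm_eq_abs, Real.norm_eq_abs,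
    abs_two]
  have h3 := Real.mul_abs_le_abs_sin (x := 2 * Real.pi * (x - m) / 2) (by
    rw [show 2 * Real.pi * (x - m) / 2 = Real.pi * (x - m) by ring, abs_mul,
      abs_of_pos Real.pi_pos]
    nlinarith [Real.pi_pos])
  rw [show 2 * Real.pi * (x - m) / 2 = Real.pi * (x - m) by ring, abs_mul,
      abs_of_pos Real.pi_pos] at h3
  rw [show 2 * Real.pi * (x - m) / 2 = Real.pi * (x - m) by ring]
  have h4 : 2 / Real.pi * (Real.pi * |x - m|) = 2 * |x - m| := by
    field_simp
  linarith

/-- Localization: the Dirichlet kernel does not see a function that vanishes to first order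
at the only integer nearby. -/
theorem tendsto_integral_mul_dirichletKer_zero {a b : ℝ} (hab : a ≤ b) {m : ℤ}
    (ha : (m : ℝ) - 1 / 2 ≤ a) (hb : b ≤ m + 1 / 2) {g : ℝ → ℂ}
    (hg : ContinuousOn g (Set.Icc a b)) {K : ℝ} (hK : ∀ x ∈ Set.Icc a b, ‖g x‖ ≤ K * |x - m|) :
    Tendsto (fun R : ℕ => ∫ x in a..b, g x * dirichletKer R x) atTop (nhds 0) := by
  have hee : Continuous ee := by simpa using continuous_ee_mul 1
  have hlow : ∀ x ∈ Set.Icc a b, 4 * |x - m| ≤ ‖ee x - 1‖ := fun x hx =>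
    four_mul_abs_le_norm_ee_sub_one (abs_le.2 ⟨by linarith [hx.1], by linarith [hx.2]⟩)
  have hint : IntervalIntegrable (fun x => g x / (ee x - 1)) MeasureTheory.volume a b := by
    rw [intervalIntegrable_iff_integrableOn_Icc_of_le hab]
    refine MeasureTheory.Integrable.of_bound (C := |K|) ?_ ?_
    · have h1 : AEMeasurable g (MeasureTheory.volume.restrict (Set.Icc a b)) :=
        hg.aemeasurable measurableSet_Icc
      exact (h1.div (hee.sub continuous_const).measurable.aemeasurable).aestronglyMeasurable
    · refine (MeasureTheory.ae_restrict_iff' measurableSet_Icc).2 (Eventually.of_forall ?_)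
      intro x hx
      rw [norm_div]
      refine div_le_of_le_mul₀ (norm_nonneg _) (abs_nonneg _) ?_
      nlinarith [hK x hx, hlow x hx, abs_nonneg (x - m), abs_nonneg K, le_abs_self K]
  have hf1 : Tendsto (fun R : ℕ => (R : ℝ) + 1) atTop (cocompact ℝ) :=
    (tendsto_natCast_atTop_atTop.atTop_add tendsto_const_nhds).mono_right atTop_le_cocompact
  have hf2 : Tendsto (fun R : ℕ => -(R : ℝ)) atTop (cocompact ℝ) :=
    (tendsto_neg_atTop_atBot.comp tendsto_natCast_atTop_atTop).mono_right atBot_le_cocompact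
  have hlim := ((tendsto_integral_mul_ee hab fun x => g x / (ee x - 1)).comp hf1).sub
    ((tendsto_integral_mul_ee hab fun x => g x / (ee x - 1)).comp hf2)
  rw [sub_zero] at hlim
  refine hlim.congr fun R => ?_
  simp only [Function.comp]
  rw [← intervalIntegral.integral_sub
    (hint.mul_continuousOn (continuous_ee_mul _).continuousOn)
    (hint.mul_continuousOn (continuous_ee_mul _).continuousOn)]
  refine intervalIntegral.integral_congr fun x hx => ?_
  rw [Set.uIcc_of_le hab] at hx
  rw [← mul_sub, ← dirichletKer_mul]
  by_cases h0 : ee x - 1 = 0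
  · have h1 := hlow x hx
    rw [h0, norm_zero] at h1
    have h2 : |x - m| = 0 := le_antisymm (by linarith) (abs_nonneg _)
    have h3 := hK x hx
    rw [h2, mul_zero, norm_le_zero_iff] at h3
    simp [h3]
  · field_simp

theorem tendsto_integral_dirichletKer_right {m : ℤ} {t : ℝ} (h0 : (m : ℝ) < t)
    (ht : t ≤ m + 1 / 2) :
    Tendsto (fun R : ℕ => ∫ x in (m : ℝ)..t, dirichletKer R x) atTop (nhds (1 / 2)) := by
  have h := tendsto_integral_mul_dirichletKer_zero ht (m := m) (by linarith) le_rfl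
    (g := fun _ => 1) continuousOn_const (K := 1 / (t - m)) (by
      intro x hx
      rw [norm_one, div_mul_eq_mul_div, one_mul, le_div_iff₀ (by linarith), one_mul]
      exact (by linarith [hx.1] : t - m ≤ x - m).trans (le_abs_self _))
  have h2 := (tendsto_const_nhds (x := (1 / 2 : ℂ))).sub h
  rw [sub_zero] at h2
  refine h2.congr fun R => ?_
  simp only [one_mul]
  rw [← integral_dirichletKer_half R m, sub_eq_iff_eq_add]
  exact (intervalIntegral.integral_add_adjacent_intervals
    ((continuous_dirichletKer R).intervalIntegrable _ _)
    ((continuous_dirichletKer R).intervalIntegrable _ _)).symm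

theorem tendsto_integral_dirichletKer_sign {m : ℤ} {t : ℝ} (ht : |t - m| ≤ 1 / 2) :
    Tendsto (fun R : ℕ => ∫ x in (m : ℝ)..t, dirichletKer R x) atTop
      (nhds ((Real.sign (t - m) : ℂ) / 2)) := by
  rw [abs_le] at ht
  rcases lt_trichotomy t m with h | h | h
  · have h1 := (tendsto_integral_dirichletKer_right (m := m) (t := 2 * m - t) (by linarith)
      (by linarith)).neg
    rw [Real.sign_of_neg (by linarith)]
    convert h1 using 2 with R
    · rw [← integral_dirichletKer_reflect, intervalIntegral.integral_symm]
    · push_cast; ring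
  · simp [h]
  · rw [Real.sign_of_pos (by linarith)]
    simpa using tendsto_integral_dirichletKer_right h (by linarith)

theorem tendsto_integral_dirichletKer {m : ℤ} {c d : ℝ} (hc : |c - m| ≤ 1 / 2)
    (hd : |d - m| ≤ 1 / 2) :
    Tendsto (fun R : ℕ => ∫ x in c..d, dirichletKer R x) atTop
      (nhds (((Real.sign (d - m) : ℂ) - Real.sign (c - m)) / 2)) := by
  have h := (tendsto_integral_dirichletKer_sign hd).sub (tendsto_integral_dirichletKer_sign hc)
  rw [← sub_div] at h
  refine h.congr fun R => ?_
  rw [intervalIntegral.integral_interval_sub_left] <;>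
    exact (continuous_dirichletKer R).intervalIntegrable _ _

theorem sign_sub_eq_sign_sub {m n : ℤ} (hmn : n ≠ m) {c d : ℝ} (hc : |c - m| ≤ 1 / 2)
    (hd : |d - m| ≤ 1 / 2) : Real.sign (d - n) = Real.sign (c - n) := by
  rw [abs_le] at hc hd
  rcases lt_or_gt_of_ne hmn with h | h
  · have : (n : ℝ) + 1 ≤ m := by exact_mod_cast h
    rw [Real.sign_of_pos (by linarith), Real.sign_of_pos (by linarith)]
  · have : (m : ℝ) + 1 ≤ n := by exact_mod_cast h
    rw [Real.sign_of_neg (by linarith), Real.sign_of_neg (by linarith)]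

theorem tendsto_integral_mul_dirichletKer_block {a b : ℝ} {f : ℝ → ℂ} {K : NNReal}
    (hf : LipschitzOnWith K f (Set.Icc a b)) {m : ℤ} {c d : ℝ} (hac : a ≤ c) (hcd : c ≤ d)
    (hdb : d ≤ b) (hc : (m : ℝ) - 1 / 2 ≤ c) (hd : d ≤ m + 1 / 2) :
    Tendsto (fun R : ℕ => ∫ x in c..d, f x * dirichletKer R x) atTop
      (nhds (∑ n ∈ Finset.Icc ⌈a⌉ ⌊b⌋,
        ((Real.sign (d - n) : ℂ) - Real.sign (c - n)) / 2 * f n)) := by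
  have hsub : Set.Icc c d ⊆ Set.Icc a b := Set.Icc_subset_Icc hac hdb
  have hfc : ContinuousOn f (Set.Icc c d) := hf.continuousOn.mono hsub
  have hc' : |c - m| ≤ 1 / 2 := abs_le.2 ⟨by linarith, by linarith⟩
  have hd' : |d - m| ≤ 1 / 2 := abs_le.2 ⟨by linarith, by linarith⟩
  by_cases hm : (m : ℝ) ∈ Set.Icc c d
  · have hsum : ∑ n ∈ Finset.Icc ⌈a⌉ ⌊b⌋,
        ((Real.sign (d - n) : ℂ) - Real.sign (c - n)) / 2 * f n =
        ((Real.sign (d - m) : ℂ) - Real.sign (c - m)) / 2 * f m := by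
      refine Finset.sum_eq_single_of_mem m ?_ ?_
      · rw [Finset.mem_Icc, Int.ceil_le, Int.le_floor]
        exact hsub hm
      · intro n _ hn
        rw [sign_sub_eq_sign_sub hn hc' hd']
        simp
    rw [hsum]
    have h1 := tendsto_integral_mul_dirichletKer_zero hcd hc hd
      (g := fun x => f x - f m) (hfc.sub continuousOn_const) (K := K) (by
        intro x hx
        have := hf.dist_le_mul x (hsub hx) m (hsub hm)
        rwa [dist_eq_norm, Real.dist_eq] at this)
    have h2 := h1.add ((tendsto_integral_dirichletKer hc' hd').mul_const (f m))
    rw [zero_add] at h2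
    refine h2.congr fun R => ?_
    rw [← intervalIntegral.integral_mul_const, ← intervalIntegral.integral_add]
    · congr 1
      ext x
      ring
    · refine ContinuousOn.intervalIntegrable ?_
      rw [Set.uIcc_of_le hcd]
      exact (hfc.sub continuousOn_const).mul (continuous_dirichletKer R).continuousOn
    · exact ((continuous_dirichletKer R).mul continuous_const).intervalIntegrable _ _
  · have hsum : ∑ n ∈ Finset.Icc ⌈a⌉ ⌊b⌋,
        ((Real.sign (d - n) : ℂ) - Real.sign (c - n)) / 2 * f n = 0 := by
      refine Finset.sum_eq_zero fun n _ => ?_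
      have : Real.sign (d - n) = Real.sign (c - n) := by
        by_cases hn : n = m
        · subst hn
          rcases lt_or_ge (n : ℝ) c with h | h
          · rw [Real.sign_of_pos (by linarith), Real.sign_of_pos (by linarith)]
          · have h' : d < n := not_le.1 fun h' => hm ⟨h, h'⟩
            rw [Real.sign_of_neg (by linarith), Real.sign_of_neg (by linarith)]
        · exact sign_sub_eq_sign_sub hn hc' hd'
      rw [this]
      simp
    rw [hsum]
    have hne : ∀ x ∈ Set.Icc c d, |x - m| ≠ 0 := by
      intro x hx h
      rw [abs_eq_zero, sub_eq_zero] at h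
      exact hm (h ▸ hx)
    have hq : ContinuousOn (fun x => ‖f x‖ / |x - m|) (Set.Icc c d) :=
      hfc.norm.div (by fun_prop) hne
    obtain ⟨C, hC⟩ := isCompact_Icc.exists_bound_of_continuousOn hq
    refine tendsto_integral_mul_dirichletKer_zero hcd hc hd hfc (K := C) fun x hx => ?_
    rw [← div_le_iff₀ (lt_of_le_of_ne (abs_nonneg _) (hne x hx).symm)]
    exact (le_abs_self _).trans (hC x hx)

theorem tendsto_integral_mul_dirichletKer {a b : ℝ} {f : ℝ → ℂ} {K : NNReal}
    (hf : LipschitzOnWith K f (Set.Icc a b)) (k : ℕ) {t : ℝ} (hat : a ≤ t) (htb : t ≤ b)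
    (ht : t ≤ round a + k + 1 / 2) :
    Tendsto (fun R : ℕ => ∫ x in a..t, f x * dirichletKer R x) atTop
      (nhds (∑ n ∈ Finset.Icc ⌈a⌉ ⌊b⌋,
        ((Real.sign (t - n) : ℂ) - Real.sign (a - n)) / 2 * f n)) := by
  have hround := abs_le.1 (abs_sub_round a)
  induction k generalizing t with
  | zero =>
    refine tendsto_integral_mul_dirichletKer_block hf le_rfl hat htb (m := round a) ?_ ?_
    · linarith
    · simpa using ht
  | succ k ih =>
    rcases le_total t (round a + k + 1 / 2) with h | h
    · exact ih hat htb h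
    · have hk : (0 : ℝ) ≤ k := k.cast_nonneg
      have hac : a ≤ round a + k + 1 / 2 := by linarith
      have h1 := ih hac (h.trans htb) le_rfl
      have h2 := tendsto_integral_mul_dirichletKer_block hf hac h htb (m := round a + k + 1)
        (by push_cast; linarith) (by push_cast at ht ⊢; linarith)
      have h3 := h1.add h2
      rw [← Finset.sum_add_distrib] at h3
      convert h3 using 2 with R
      · have hint : ∀ u v : ℝ, u ∈ Set.Icc a b → v ∈ Set.Icc a b →
            IntervalIntegrable (fun x => f x * dirichletKer R x) MeasureTheory.volume u v :=
          fun u v hu hv => ((hf.continuousOn.mono (Set.uIcc_subset_Icc hu hv)).mul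
            (continuous_dirichletKer R).continuousOn).intervalIntegrable
        exact (intervalIntegral.integral_add_adjacent_intervals
          (hint _ _ ⟨le_rfl, hat.trans htb⟩ ⟨hac, h.trans htb⟩)
          (hint _ _ ⟨hac, h.trans htb⟩ ⟨hat, htb⟩)).symm
      · refine Finset.sum_congr rfl fun n _ => ?_
        ring

theorem starSum_eq_sum_sign {a b : ℝ} (hab : a < b) (h : ℤ → ℂ) :
    starSum a b h = ∑ n ∈ Finset.Icc ⌈a⌉ ⌊b⌋,
      ((Real.sign (b - n) : ℂ) - Real.sign (a - n)) / 2 * h n := by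
  unfold starSum
  refine Finset.sum_congr rfl fun n hn => ?_
  rw [Finset.mem_Icc, Int.ceil_le, Int.le_floor] at hn
  congr 1
  rcases hn.1.eq_or_lt with h1 | h1
  · rw [if_pos (Or.inl h1.symm), ← h1, Real.sign_of_pos (by linarith)]
    simp
  · rcases hn.2.eq_or_lt with h2 | h2
    · rw [if_pos (Or.inr h2), h2, Real.sign_of_neg (r := a - b) (by linarith)]
      simp
    · rw [if_neg (by rintro (h | h) <;> linarith), Real.sign_of_pos (by linarith),
        Real.sign_of_neg (by linarith)]
      norm_num

/-- Poisson summation: for `f ∈ C²([a,b])`,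
`lim_{R→∞} Σ_{r=−R}^{R} ∫_a^b f(x)e(rx) dx = Σ*_{a≤n≤b} f(n)`. -/
theorem stmt14 (a b : ℝ) (hab : a < b) (f : ℝ → ℂ)
    (hf : ContDiffOn ℝ 2 f (Set.Icc a b)) :
    Tendsto (fun R : ℕ => ∑ r ∈ Finset.Icc (-(R : ℤ)) (R : ℤ), ∫ x in a..b, f x * ee ((r : ℝ) * x))
      atTop (nhds (starSum a b (fun n => f (n : ℝ)))) := by
  obtain ⟨K, hK⟩ := (hf.of_le one_le_two).exists_lipschitzOnWith one_ne_zero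
    (convex_Icc a b) isCompact_Icc
  rw [starSum_eq_sum_sign hab]
  obtain ⟨k, hk⟩ := exists_nat_ge (b - round a)
  refine (tendsto_integral_mul_dirichletKer hK k hab.le le_rfl (by linarith)).congr fun R => ?_
  simp only [dirichletKer, Finset.mul_sum]
  refine intervalIntegral.integral_finsetSum fun r _ => ContinuousOn.intervalIntegrable ?_
  rw [Set.uIcc_of_le hab.le]
  exact hf.continuousOn.mul (continuous_ee_mul r).continuousOn
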